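/- Let g be an entire function of order at most 1 that is not identically zero, and suppose φ = g''/g extends to an entire function. Then φ is constant. -/

import Mathlib

open Complex Metric Set MeasureTheory

lemma aux_int_pos (c d : ℝ) (hc : 0 ≤ c) (hcd : c ≤ d) :
    IntervalIntegrable (fun x : ℝ => |x| ^ (-4/5 : ℝ)) volume c d ∧
    ∫ x in c..d, |x| ^ (-4/5 : ℝ) ≤ 5 * (d - c) ^ (1/5 : ℝ) := by
  have he : ∀ x ∈ Set.uIcc c d, |x| ^ (-4/5 : ℝ) = x ^ (-4/5 : ℝ) := by
    intro x hx
    rw [Set.uIcc_of_le hcd] at hx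
    rw [abs_of_nonneg (hc.trans hx.1)]
  constructor
  · refine (intervalIntegral.intervalIntegrable_rpow' (r := (-4/5 : ℝ)) (by norm_num)).congr ?_
    intro x hx
    exact (he x (Set.uIoc_subset_uIcc hx)).symm
  · rw [intervalIntegral.integral_congr he, integral_rpow (Or.inl (by norm_num))]
    have := Real.rpow_add_le_add_rpow (sub_nonneg.2 hcd) hc
      (by norm_num : (0:ℝ) ≤ 1/5) (by norm_num : (1/5:ℝ) ≤ 1)
    rw [sub_add_cancel] at this
    norm_num at this ⊢
    linarith

lemma aux_int_neg (c d : ℝ) (hd : d ≤ 0) (hcd : c ≤ d) :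
    IntervalIntegrable (fun x : ℝ => |x| ^ (-4/5 : ℝ)) volume c d ∧
    ∫ x in c..d, |x| ^ (-4/5 : ℝ) ≤ 5 * (d - c) ^ (1/5 : ℝ) := by
  have h := aux_int_pos (-d) (-c) (by linarith) (by linarith)
  constructor
  · have := (intervalIntegrable_iff_integrableOn_Ioc_of_le (by linarith)).1 h.1
    have h2 := (IntervalIntegrable.iff_comp_neg).1 h.1
    simpa using h2.symm
  · have h2 := h.2
    have := intervalIntegral.integral_comp_neg (a := c) (b := d) (fun x : ℝ => |x| ^ (-4/5 : ℝ))
    simp only [abs_neg] at this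
    rw [this]
    convert h2 using 3
    ring

lemma aux_int (c d : ℝ) (hcd : c ≤ d) :
    IntervalIntegrable (fun x : ℝ => |x| ^ (-4/5 : ℝ)) volume c d ∧
    ∫ x in c..d, |x| ^ (-4/5 : ℝ) ≤ 10 * (d - c) ^ (1/5 : ℝ) := by
  have hp : 0 ≤ (d - c) ^ (1/5 : ℝ) := Real.rpow_nonneg (by linarith) _
  rcases le_total 0 c with hc | hc
  · have := aux_int_pos c d hc hcd
    exact ⟨this.1, by linarith [this.2]⟩
  rcases le_total d 0 with hd | hd
  · have := aux_int_neg c d hd hcd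
    exact ⟨this.1, by linarith [this.2]⟩
  have h1 := aux_int_neg c 0 le_rfl hc
  have h2 := aux_int_pos 0 d le_rfl hd
  refine ⟨h1.1.trans h2.1, ?_⟩
  rw [← intervalIntegral.integral_add_adjacent_intervals h1.1 h2.1]
  have h3 : (0 - c) ^ (1/5 : ℝ) ≤ (d - c) ^ (1/5 : ℝ) := by gcongr
  have h4 : (d - 0) ^ (1/5 : ℝ) ≤ (d - c) ^ (1/5 : ℝ) := by gcongr
  linarith [h1.2, h2.2]

lemma aux_sum {ι : Type*} [Fintype ι] (x : ι → ℝ) (hx : ∀ i, 0 < x i) :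
    ∑ i, x i ≤ (∑ i, (x i) ^ (4/5 : ℝ)) ^ (5/4 : ℝ) := by
  set S := ∑ i, (x i) ^ (4/5 : ℝ) with hS
  have hS0 : 0 ≤ S := Finset.sum_nonneg fun i _ => (Real.rpow_pos_of_pos (hx i) _).le
  have h1 : ∀ i, x i ≤ (x i) ^ (4/5 : ℝ) * S ^ (1/4 : ℝ) := by
    intro i
    have h2 : (x i) ^ (4/5 : ℝ) ≤ S :=
      Finset.single_le_sum (f := fun i => (x i) ^ (4/5 : ℝ))
        (fun i _ => (Real.rpow_pos_of_pos (hx i) _).le) (Finset.mem_univ i)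
    have h3 : ((x i) ^ (4/5 : ℝ)) ^ (1/4 : ℝ) ≤ S ^ (1/4 : ℝ) :=
      Real.rpow_le_rpow (Real.rpow_pos_of_pos (hx i) _).le h2 (by norm_num)
    rw [← Real.rpow_mul (hx i).le] at h3
    calc x i = (x i) ^ (4/5 : ℝ) * (x i) ^ (4/5 * (1/4) : ℝ) := by
          rw [← Real.rpow_add (hx i)]; norm_num
      _ ≤ _ := by
          have := (Real.rpow_pos_of_pos (hx i) (4/5)).le
          gcongr
  calc ∑ i, x i ≤ ∑ i, (x i) ^ (4/5 : ℝ) * S ^ (1/4 : ℝ) := Finset.sum_le_sum fun i _ => h1 i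
    _ = S * S ^ (1/4 : ℝ) := by rw [← Finset.sum_mul]
    _ = S ^ (5/4 : ℝ) := by
      rw [show (5/4 : ℝ) = 1 + 1/4 by norm_num, Real.rpow_add' hS0 (by norm_num), Real.rpow_one]

lemma aux_radius {ι : Type*} [Fintype ι] (b : ι → ℝ) (ρ : ℝ) (hρ : 0 < ρ) :
    ∃ r, ρ ≤ r ∧ r ≤ 2 * ρ ∧ (∀ i, r ≠ b i) ∧
      ∑ i, 1 / |r - b i| ≤ (10 * Fintype.card ι * ρ ^ (-4/5 : ℝ)) ^ (5/4 : ℝ) := by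
  have hI : ∀ i, IntervalIntegrable (fun x : ℝ => |x - b i| ^ (-4/5 : ℝ)) volume ρ (2*ρ) ∧
    ∫ x in ρ..(2*ρ), |x - b i| ^ (-4/5 : ℝ) ≤ 10 * ρ ^ (1/5 : ℝ) := by
    intro i
    have h := aux_int (ρ - b i) (2*ρ - b i) (by linarith)
    constructor
    · have := h.1.comp_sub_right (b i)
      simpa using this
    · rw [intervalIntegral.integral_comp_sub_right (fun x : ℝ => |x| ^ (-4/5 : ℝ))]
      convert h.2 using 3
      ring
  set f : ℝ → ℝ := fun x => ∑ i, |x - b i| ^ (-4/5 : ℝ) with hf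
  have hfi : IntegrableOn f (Ioc ρ (2*ρ)) volume := by
    apply integrable_finsetSum
    intro i _
    exact (intervalIntegrable_iff_integrableOn_Ioc_of_le (by linarith)).1 (hI i).1
  have hN : (volume.restrict (Ioc ρ (2*ρ))) (Set.range b ∪ (Ioc ρ (2*ρ))ᶜ) = 0 := by
    refine measure_union_null ?_ ?_
    · exact (Set.finite_range b).measure_zero _
    · rw [Measure.restrict_apply measurableSet_Ioc.compl]; simp
  have hne : (volume.restrict (Ioc ρ (2*ρ))) ≠ 0 := by
    intro h
    have := congrArg (fun m => m Set.univ) h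
    simp at this
    linarith
  obtain ⟨r, hr, hle⟩ := exists_notMem_null_le_average hne hfi hN
  simp only [mem_union, mem_range, mem_compl_iff, not_or, not_not, not_exists] at hr
  have hrb : ∀ i, r ≠ b i := fun i h => hr.1 i h.symm
  refine ⟨r, hr.2.1.le, hr.2.2, hrb, ?_⟩
  have havg : ⨍ a in (Ioc ρ (2*ρ)), f a ≤ 10 * Fintype.card ι * ρ ^ (-4/5 : ℝ) := by
    rw [setAverage_eq, ← intervalIntegral.integral_of_le (by linarith), hf,
      intervalIntegral.integral_finsetSum (fun i _ => (hI i).1)]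
    have h1 : ∑ i, ∫ x in ρ..(2*ρ), |x - b i| ^ (-4/5 : ℝ) ≤ Fintype.card ι * (10 * ρ ^ (1/5 : ℝ)) := by
      refine (Finset.sum_le_sum fun i _ => (hI i).2).trans ?_
      simp
    have h2 : ρ ^ (-4/5 : ℝ) = ρ⁻¹ * ρ ^ (1/5 : ℝ) := by
      rw [← Real.rpow_neg_one, ← Real.rpow_add hρ]; norm_num
    have h3 : volume.real (Ioc ρ (2*ρ)) = ρ := by
      rw [Real.volume_real_Ioc_of_le (by linarith)]; ring
    rw [h3, smul_eq_mul, h2]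
    calc _ ≤ ρ⁻¹ * (Fintype.card ι * (10 * ρ ^ (1/5 : ℝ))) := by gcongr
      _ = _ := by ring
  have h5 := aux_sum (fun i => 1 / |r - b i|) (fun i => by
    have := abs_pos.2 (sub_ne_zero.2 (hrb i)); positivity)
  refine h5.trans ?_
  have h6 : ∑ i, (1 / |r - b i|) ^ (4/5 : ℝ) = f r := by
    rw [hf]
    refine Finset.sum_congr rfl fun i _ => ?_
    rw [one_div, Real.inv_rpow (abs_nonneg _), ← Real.rpow_neg (abs_nonneg _)]
    norm_num
  rw [h6]
  refine Real.rpow_le_rpow ?_ (hle.trans havg) (by norm_num)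
  exact Finset.sum_nonneg fun i _ => Real.rpow_nonneg (abs_nonneg _) _

/-- log-derivative of a zero-free function -/
lemma aux_zerofree (h : ℂ → ℂ) (hh : Differentiable ℂ h) (R A : ℝ) (hR : 0 < R) (hA : 0 < A)
    (h0 : ∀ z ∈ ball (0:ℂ) R, h z ≠ 0)
    (hb : ∀ z ∈ ball (0:ℂ) R, ‖h z‖ ≤ ‖h 0‖ * Real.exp A)
    (z : ℂ) (hz : ‖z‖ ≤ R / 2) : ‖logDeriv h z‖ ≤ 24 * A / R := by
  have hd : DifferentiableOn ℂ (logDeriv h) (ball 0 R) := by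
    have : Differentiable ℂ (deriv h) := hh.deriv
    exact this.differentiableOn.div hh.differentiableOn h0
  obtain ⟨L0, hL0⟩ := hd.isExactOn_ball
  set L : ℂ → ℂ := fun z => L0 z - L0 0 with hL
  have hLd : ∀ z ∈ ball (0:ℂ) R, HasDerivAt L (logDeriv h z) z := fun z hz =>
    (hL0 z hz).sub_const _
  have h00 : (0:ℂ) ∈ ball (0:ℂ) R := by simpa using hR
  have hL00 : L 0 = 0 := by simp [hL]
  have hexp : ∀ z ∈ ball (0:ℂ) R, h z = h 0 * Complex.exp (L z) := by
    have hD : ∀ z ∈ ball (0:ℂ) R, HasDerivAt (fun z => h z * Complex.exp (- L z)) 0 z := by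
      intro z hz
      have h1 := (hh z).hasDerivAt.mul ((hLd z hz).neg.cexp)
      refine HasDerivAt.congr_deriv (f := fun z => h z * Complex.exp (- L z)) h1 ?_
      rw [logDeriv_apply]
      have := h0 z hz
      simp only [Pi.neg_apply]
      field_simp
      ring
    intro z hz
    have := (isOpen_ball (x := (0:ℂ)) (ε := R)).is_const_of_deriv_eq_zero
      (convex_ball (0:ℂ) R).isPreconnected
      (fun z hz => (hD z hz).differentiableAt.differentiableWithinAt)
      (fun z hz => (hD z hz).deriv) hz h00
    simp only [hL00, neg_zero, Complex.exp_zero, mul_one] at this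
    rw [← this, mul_assoc, ← Complex.exp_add]
    simp
  have hre : Set.MapsTo L (ball 0 R) {z | z.re ≤ A} := by
    intro z hz
    have h1 := hb z hz
    rw [hexp z hz, norm_mul, Complex.norm_exp] at h1
    have h2 : 0 < ‖h 0‖ := norm_pos_iff.2 (h0 0 h00)
    exact Real.exp_le_exp.1 (le_of_mul_le_mul_left h1 h2)
  have hLdiff : DifferentiableOn ℂ L (ball 0 R) :=
    fun z hz => (hLd z hz).differentiableAt.differentiableWithinAt
  have hbc : ∀ w : ℂ, ‖w‖ ≤ 3 * R / 4 → ‖L w‖ ≤ 6 * A := by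
    intro w hw
    refine (Complex.borelCaratheodory_zero hA hLdiff hre hR
      (by rw [mem_ball_zero_iff]; linarith) hL00).trans ?_
    rw [div_le_iff₀ (by linarith)]
    nlinarith
  have hzb : z ∈ ball (0:ℂ) R := by rw [mem_ball_zero_iff]; linarith
  rw [← (hLd z hzb).deriv]
  have hsub : ∀ w ∈ closedBall z (R/4), ‖w‖ ≤ 3 * R / 4 := by
    intro w hw
    rw [mem_closedBall, dist_eq_norm] at hw
    have : ‖w‖ ≤ ‖w - z‖ + ‖z‖ := by simpa using norm_add_le (w - z) z
    linarith
  have := Complex.norm_deriv_le_of_forall_mem_sphere_norm_le (c := z) (R := R/4) (C := 6*A) (f := L)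
    (by linarith)
    (by
      apply DifferentiableOn.diffContOnCl
      refine hLdiff.mono ?_
      refine closure_ball_subset_closedBall.trans fun w hw => ?_
      rw [mem_ball_zero_iff]; linarith [hsub w hw])
    (fun w hw => hbc w (hsub w (sphere_subset_closedBall hw)))
  refine this.trans (le_of_eq ?_)
  field_simp
  norm_num

lemma aux_factor_bound (f h : ℂ → ℂ) (hh : Differentiable ℂ h) (n : ℕ)
    (a : Fin n → ℂ) (R A : ℝ) (hR : 0 < R) (ha : ∀ i, ‖a i‖ ≤ R)
    (hf : ∀ z, f z = (∏ i, (z - a i)) * h z) (hf0 : f 0 ≠ 0)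
    (hb : ∀ z, ‖z‖ ≤ 4 * R → ‖f z‖ ≤ ‖f 0‖ * Real.exp A) :
    (∀ z, ‖z‖ ≤ 4 * R → 3 ^ n * ‖h z‖ ≤ ‖h 0‖ * Real.exp A) ∧ (n : ℝ) ≤ A := by
  have h1 : ‖f 0‖ ≤ R ^ n * ‖h 0‖ := by
    rw [hf 0, norm_mul, norm_prod]
    gcongr
    calc ∏ i, ‖0 - a i‖ ≤ ∏ i : Fin n, R :=
          Finset.prod_le_prod (fun i _ => norm_nonneg _) (fun i _ => by simpa using ha i)
      _ = R ^ n := by simp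
  have hh0 : h 0 ≠ 0 := by
    intro h'; apply hf0; rw [hf 0, h', mul_zero]
  have h2 : ∀ z ∈ sphere (0:ℂ) (4 * R), ‖h z‖ ≤ ‖h 0‖ * Real.exp A / 3 ^ n := by
    intro z hz
    rw [mem_sphere_zero_iff_norm] at hz
    have h3 := hb z hz.le
    rw [hf z, norm_mul, norm_prod] at h3
    have h4 : (3 * R) ^ n ≤ ∏ i, ‖z - a i‖ := by
      calc (3 * R) ^ n = ∏ i : Fin n, (3 * R) := by simp
        _ ≤ _ := Finset.prod_le_prod (fun i _ => by positivity) (fun i _ => by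
          have := norm_sub_norm_le z (a i)
          have := ha i
          linarith)
    rw [le_div_iff₀ (by positivity)]
    have h5 : R ^ n * (‖h z‖ * 3 ^ n) ≤ R ^ n * (‖h 0‖ * Real.exp A) := by
      calc R ^ n * (‖h z‖ * 3 ^ n) = (3 * R) ^ n * ‖h z‖ := by rw [mul_pow]; ring
        _ ≤ (∏ i, ‖z - a i‖) * ‖h z‖ := by gcongr
        _ ≤ ‖f 0‖ * Real.exp A := h3
        _ ≤ (R ^ n * ‖h 0‖) * Real.exp A := by gcongr
        _ = _ := by ring
    exact le_of_mul_le_mul_left h5 (by positivity)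
  have h3 : ∀ z, ‖z‖ ≤ 4 * R → 3 ^ n * ‖h z‖ ≤ ‖h 0‖ * Real.exp A := by
    intro z hz
    have := Complex.norm_le_of_forall_mem_frontier_norm_le (U := ball (0:ℂ) (4*R)) isBounded_ball
      (hh.diffContOnCl) (C := ‖h 0‖ * Real.exp A / 3 ^ n)
      (by rw [frontier_ball _ (by positivity)]; exact h2)
      (z := z) (by rw [closure_ball _ (by positivity)]; simpa using hz)
    rw [le_div_iff₀ (by positivity)] at this
    linarith
  refine ⟨h3, ?_⟩
  have h4 := h3 0 (by simp; positivity)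
  rw [mul_comm] at h4
  have h5 : (3:ℝ) ^ n ≤ Real.exp A := le_of_mul_le_mul_left h4 (norm_pos_iff.2 hh0)
  have h6 : Real.exp n ≤ 3 ^ n := by
    have : Real.exp n = Real.exp 1 ^ n := by rw [← Real.exp_nat_mul, mul_one]
    rw [this]
    gcongr
    linarith [Real.exp_one_lt_d9]
  exact Real.exp_le_exp.1 (h6.trans h5)

lemma aux_factor (f : ℂ → ℂ) (hfd : Differentiable ℂ f) (R A : ℝ) (hR : 0 < R)
    (hf0 : f 0 ≠ 0)
    (hb : ∀ z, ‖z‖ ≤ 4 * R → ‖f z‖ ≤ ‖f 0‖ * Real.exp A) :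
    ∃ (n : ℕ) (a : Fin n → ℂ) (h : ℂ → ℂ), Differentiable ℂ h ∧ (∀ i, ‖a i‖ ≤ R) ∧
      (∀ z, f z = (∏ i, (z - a i)) * h z) ∧ (∀ z, ‖z‖ ≤ R → h z ≠ 0) := by
  by_contra hcon
  push Not at hcon
  have key : ∀ n : ℕ, ∃ (a : Fin n → ℂ) (h : ℂ → ℂ), Differentiable ℂ h ∧ (∀ i, ‖a i‖ ≤ R) ∧
      (∀ z, f z = (∏ i, (z - a i)) * h z) := by
    intro n
    induction n with
    | zero => exact ⟨Fin.elim0, f, hfd, fun i => i.elim0, fun z => by simp⟩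
    | succ n ih =>
      obtain ⟨a, h, hh, ha, hf⟩ := ih
      obtain ⟨w, hw, hw0⟩ := hcon n a h hh ha hf
      refine ⟨Fin.cons w a, dslope h w, ?_, ?_, ?_⟩
      · have := (Complex.differentiableOn_dslope (f := h) (c := w) (s := Set.univ)
          Filter.univ_mem).2 hh.differentiableOn
        exact differentiableOn_univ.1 this
      · intro i
        refine Fin.cases ?_ ?_ i
        · simpa using hw
        · intro j; simpa using ha j
      · intro z
        rw [hf z, Fin.prod_univ_succ]
        simp only [Fin.cons_zero, Fin.cons_succ]
        have := sub_smul_dslope h w z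
        rw [hw0, sub_zero, smul_eq_mul] at this
        rw [← this]; ring
  obtain ⟨n, hn⟩ := exists_nat_gt A
  obtain ⟨a, h, hh, ha, hf⟩ := key n
  have := (aux_factor_bound f h hh n a R A hR ha hf hf0 hb).2
  linarith

lemma aux_logDeriv (f : ℂ → ℂ) (hfd : Differentiable ℂ f) (ρ A : ℝ) (hρ : 0 < ρ) (hA : 0 < A)
    (hf0 : f 0 ≠ 0)
    (hb : ∀ z, ‖z‖ ≤ 16 * ρ → ‖f z‖ ≤ ‖f 0‖ * Real.exp A) :
    ∃ (n : ℕ) (b : Fin n → ℝ), (n : ℝ) ≤ A ∧ ∀ z : ℂ, ‖z‖ ≤ 2 * ρ → (∀ i, ‖z‖ ≠ b i) →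
      f z ≠ 0 ∧ ‖deriv f z / f z‖ ≤ ∑ i, 1 / |‖z‖ - b i| + 6 * A / ρ := by
  have hb' : ∀ z, ‖z‖ ≤ 4 * (4 * ρ) → ‖f z‖ ≤ ‖f 0‖ * Real.exp A := fun z hz => 
    hb z (by linarith)
  obtain ⟨n, a, h, hh, ha, hf, hne⟩ := aux_factor f hfd (4*ρ) A (by positivity) hf0 hb'
  obtain ⟨h1, h2⟩ := aux_factor_bound f h hh n a (4*ρ) A (by positivity) ha hf hf0 hb'
  refine ⟨n, fun i => ‖a i‖, h2, fun z hz hzb => ?_⟩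
  have hza : ∀ i, z - a i ≠ 0 := fun i h' => hzb i (by rw [sub_eq_zero.1 h'])
  have hhz : h z ≠ 0 := hne z (by linarith)
  have hP : ∏ i, (z - a i) ≠ 0 := Finset.prod_ne_zero_iff.2 fun i _ => hza i
  refine ⟨by rw [hf z]; exact mul_ne_zero hP hhz, ?_⟩
  have hfe : f = fun z => (∏ i, (z - a i)) * h z := funext hf
  rw [← logDeriv_apply, hfe, logDeriv_mul (f := fun z => ∏ i, (z - a i)) z hP hhz (by fun_prop) (hh z),
    logDeriv_prod (f := fun i z => z - a i) (fun i _ => hza i) (fun i _ => by fun_prop)]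
  refine (norm_add_le _ _).trans (add_le_add ?_ ?_)
  · refine (norm_sum_le _ _).trans (Finset.sum_le_sum fun i _ => ?_)
    rw [logDeriv_apply, deriv_sub_const, deriv_id'', norm_div, norm_one]
    have := abs_pos.2 (sub_ne_zero.2 (hzb i))
    gcongr
    exact abs_norm_sub_norm_le z (a i)
  · have := aux_zerofree h hh (4*ρ) A (by positivity) hA
      (fun w hw => hne w (mem_ball_zero_iff.1 hw).le)
      (fun w hw => by
        have hw' := (mem_ball_zero_iff.1 hw).le
        refine le_trans ?_ (h1 w (by linarith))
        have : (1:ℝ) ≤ 3 ^ n := one_le_pow₀ (by norm_num)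
        nlinarith [norm_nonneg (h w)])
      z (by linarith)
    refine this.trans (le_of_eq ?_)
    field_simp
    norm_num

lemma aux_liouville (φ : ℂ → ℂ) (hφ : Differentiable ℂ φ) (K : ℝ)
    (h : ∀ ρ : ℝ, 1 ≤ ρ → ∃ r, ρ ≤ r ∧ ∀ z : ℂ, ‖z‖ = r → ‖φ z‖ ≤ K * ρ ^ (3/4 : ℝ)) :
    ∃ k : ℂ, ∀ z, φ z = k := by
  have hb : ∀ ρ : ℝ, 1 ≤ ρ → ∀ z : ℂ, ‖z‖ ≤ ρ → ‖φ z‖ ≤ K * ρ ^ (3/4 : ℝ) := by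
    intro ρ hρ z hz
    obtain ⟨r, hr, hr2⟩ := h ρ hρ
    have hr0 : 0 < r := by linarith
    exact Complex.norm_le_of_forall_mem_frontier_norm_le (U := ball (0:ℂ) r) isBounded_ball
      (hφ.diffContOnCl)
      (by rw [frontier_ball _ hr0.ne']; exact fun w hw => hr2 w (by simpa using hw))
      (z := z) (by rw [closure_ball _ hr0.ne']; simpa using hz.trans hr)
  have hd : ∀ w, deriv φ w = 0 := by
    intro w
    have hle : ∀ ρ : ℝ, 1 + ‖w‖ ≤ ρ → ‖deriv φ w‖ ≤ K * 2 ^ (3/4 : ℝ) * ρ ^ (-(1/4) : ℝ) := by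
      intro ρ hρ
      have hw := norm_nonneg w
      have hρ0 : 0 < ρ := by linarith
      have := Complex.norm_deriv_le_of_forall_mem_sphere_norm_le (c := w) (R := ρ)
        (C := K * (2 * ρ) ^ (3/4 : ℝ)) (f := φ) hρ0 hφ.diffContOnCl
        (fun z hz => hb (2*ρ) (by linarith) z (by
          rw [mem_sphere, dist_eq_norm] at hz
          have : ‖z‖ ≤ ‖z - w‖ + ‖w‖ := by simpa using norm_add_le (z - w) w
          linarith))
      refine this.trans (le_of_eq ?_)
      rw [Real.mul_rpow (by norm_num) hρ0.le, show (-(1/4) : ℝ) = 3/4 - 1 by norm_num,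
        Real.rpow_sub_one hρ0.ne']
      ring
    have hlim : Filter.Tendsto (fun ρ : ℝ => K * 2 ^ (3/4 : ℝ) * ρ ^ (-(1/4) : ℝ)) Filter.atTop
        (nhds (K * 2 ^ (3/4 : ℝ) * 0)) :=
      (tendsto_rpow_neg_atTop (by norm_num)).const_mul _
    rw [mul_zero] at hlim
    have := ge_of_tendsto hlim (Filter.eventually_atTop.2 ⟨1 + ‖w‖, hle⟩)
    exact norm_le_zero_iff.1 this
  exact ⟨φ 0, fun z => is_const_of_deriv_eq_zero hφ hd z 0⟩

lemma aux_core (g φ : ℂ → ℂ) (hg : Differentiable ℂ g) (hφ : Differentiable ℂ φ)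
    (hquot : ∀ z : ℂ, φ z * g z = deriv (deriv g) z)
    (h0 : g 0 ≠ 0) (h1 : deriv g 0 ≠ 0) (K : ℝ) (hK : 0 < K)
    (hb0 : ∀ ρ : ℝ, 1 ≤ ρ → ∀ z, ‖z‖ ≤ 16 * ρ → ‖g z‖ ≤ ‖g 0‖ * Real.exp (K * ρ ^ (11/10 : ℝ)))
    (hb1 : ∀ ρ : ℝ, 1 ≤ ρ → ∀ z, ‖z‖ ≤ 16 * ρ →
      ‖deriv g z‖ ≤ ‖deriv g 0‖ * Real.exp (K * ρ ^ (11/10 : ℝ))) :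
    ∃ k : ℂ, ∀ z, φ z = k := by
  set M : ℝ := (20 * K) ^ (5/4 : ℝ) + 6 * K with hM
  refine aux_liouville φ hφ (M * M) fun ρ hρ => ?_
  have hρ0 : 0 < ρ := by linarith
  have hA : 0 < K * ρ ^ (11/10 : ℝ) := by positivity
  obtain ⟨n, b, hn, hbn⟩ := aux_logDeriv g hg ρ _ hρ0 hA h0 (hb0 ρ hρ)
  obtain ⟨m, c, hm, hcm⟩ := aux_logDeriv (deriv g) hg.deriv ρ _ hρ0 hA h1 (hb1 ρ hρ)
  obtain ⟨r, hr1, hr2, hrb, hrs⟩ := aux_radius (Sum.elim b c) ρ hρ0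
  refine ⟨r, hr1, fun z hz => ?_⟩
  rw [← hz] at hrb hrs hr2
  obtain ⟨hgz, hg1⟩ := hbn z hr2 (fun i => hrb (Sum.inl i))
  obtain ⟨hgz', hg2⟩ := hcm z hr2 (fun i => hrb (Sum.inr i))
  rw [Fintype.sum_sum_type] at hrs
  simp only [Sum.elim_inl, Sum.elim_inr, Fintype.card_sum, Fintype.card_fin, Nat.cast_add] at hrs
  have hs1 : 0 ≤ ∑ i, 1 / |‖z‖ - b i| := Finset.sum_nonneg fun i _ => by positivity
  have hs2 : 0 ≤ ∑ i, 1 / |‖z‖ - c i| := Finset.sum_nonneg fun i _ => by positivity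
  have hS : (10 * ((n:ℝ) + m) * ρ ^ (-4/5 : ℝ)) ^ (5/4 : ℝ) ≤ (20 * K) ^ (5/4 : ℝ) * ρ ^ (3/8 : ℝ) := by
    calc (10 * ((n:ℝ) + m) * ρ ^ (-4/5 : ℝ)) ^ (5/4 : ℝ)
        ≤ (10 * (K * ρ ^ (11/10 : ℝ) + K * ρ ^ (11/10 : ℝ)) * ρ ^ (-4/5 : ℝ)) ^ (5/4 : ℝ) := by
          gcongr
      _ = ((20 * K) * ρ ^ (3/10 : ℝ)) ^ (5/4 : ℝ) := by
          congr 1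
          rw [show (3/10 : ℝ) = 11/10 + (-4/5) by norm_num, Real.rpow_add hρ0]
          ring
      _ = _ := by
          rw [Real.mul_rpow (by positivity) (by positivity), ← Real.rpow_mul hρ0.le]
          norm_num
  have hT : 6 * (K * ρ ^ (11/10 : ℝ)) / ρ ≤ 6 * K * ρ ^ (3/8 : ℝ) := by
    have e : ρ ^ (11/10 : ℝ) / ρ = ρ ^ (1/10 : ℝ) := by
      rw [← Real.rpow_sub_one hρ0.ne']; norm_num
    calc 6 * (K * ρ ^ (11/10 : ℝ)) / ρ = 6 * K * (ρ ^ (11/10 : ℝ) / ρ) := by ring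
      _ = 6 * K * ρ ^ (1/10 : ℝ) := by rw [e]
      _ ≤ _ := by
        gcongr 6 * K * ?_
        exact Real.rpow_le_rpow_of_exponent_le hρ (by norm_num)
  have hM1 : ‖deriv g z / g z‖ ≤ M * ρ ^ (3/8 : ℝ) := by rw [hM, add_mul]; linarith
  have hM2 : ‖deriv (deriv g) z / deriv g z‖ ≤ M * ρ ^ (3/8 : ℝ) := by rw [hM, add_mul]; linarith
  have he : φ z = (deriv (deriv g) z / deriv g z) * (deriv g z / g z) := by
    rw [← hquot z]; field_simp
  rw [he, norm_mul]
  calc _ ≤ (M * ρ ^ (3/8 : ℝ)) * (M * ρ ^ (3/8 : ℝ)) :=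
        mul_le_mul hM2 hM1 (norm_nonneg _) ((norm_nonneg _).trans hM2)
    _ = M * M * (ρ ^ (3/8 : ℝ) * ρ ^ (3/8 : ℝ)) := by ring
    _ = _ := by rw [← Real.rpow_add hρ0]; norm_num

/-- absorbing constants -/
lemma aux_absorb (C x D : ℝ) (hC : 0 < C) (hx : 0 < x) (hD : 0 < D) :
    ∃ K, 0 < K ∧ ∀ K', K ≤ K' → ∀ ρ : ℝ, 1 ≤ ρ →
      C * Real.exp ((D * ρ) ^ (11/10 : ℝ)) ≤ x * Real.exp (K' * ρ ^ (11/10 : ℝ)) := by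
  refine ⟨D ^ (11/10 : ℝ) + |Real.log (C / x)|, by positivity, fun K' hK' ρ hρ => ?_⟩
  have h1 : (1:ℝ) ≤ ρ ^ (11/10 : ℝ) := Real.one_le_rpow hρ (by norm_num)
  have h2 : C = x * Real.exp (Real.log (C / x)) := by
    rw [Real.exp_log (by positivity)]; field_simp
  rw [Real.mul_rpow hD.le (by linarith)]
  calc C * Real.exp (D ^ (11/10 : ℝ) * ρ ^ (11/10 : ℝ))
      = x * Real.exp (Real.log (C / x) + D ^ (11/10 : ℝ) * ρ ^ (11/10 : ℝ)) := by
        rw [Real.exp_add, ← mul_assoc, ← h2]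
    _ ≤ _ := by
      gcongr
      have := le_abs_self (Real.log (C / x))
      have := abs_nonneg (Real.log (C / x))
      nlinarith

theorem stmt_15 (g φ : ℂ → ℂ)
    (hg : Differentiable ℂ g)
    (hne : ∃ z, g z ≠ 0)
    (horder : ∀ ε : ℝ, 0 < ε → ∃ C : ℝ, 0 < C ∧
      ∀ z : ℂ, ‖g z‖ ≤ C * Real.exp (‖z‖ ^ (1 + ε)))
    (hφ : Differentiable ℂ φ)
    (hquot : ∀ z : ℂ, φ z * g z = deriv (deriv g) z) :
    ∃ k : ℂ, ∀ z, φ z = k := by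
  by_cases hcase : ∃ z, g z ≠ 0 ∧ deriv g z ≠ 0
  · obtain ⟨w, hw0, hw1⟩ := hcase
    have hd1 : ∀ z, deriv (fun z => g (z + w)) z = deriv g (z + w) := fun z => deriv_comp_add_const ..
    have hd1' : deriv (fun z => g (z + w)) = fun z => deriv g (z + w) := funext hd1
    have hd2 : ∀ z, deriv (deriv (fun z => g (z + w))) z = deriv (deriv g) (z + w) := fun z => by
      rw [hd1']; exact deriv_comp_add_const ..
    obtain ⟨C, hC, hgC⟩ := horder (1/10) (by norm_num)
    have hD : 0 < 17 + ‖w‖ := by positivity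
    have hB0 : ∀ ρ : ℝ, 1 ≤ ρ → ∀ z : ℂ, ‖z‖ ≤ (17 + ‖w‖) * ρ →
        ‖g z‖ ≤ C * Real.exp (((17 + ‖w‖) * ρ) ^ (11/10 : ℝ)) := by
      intro ρ hρ z hz
      refine (hgC z).trans ?_
      rw [show (1 + 1/10 : ℝ) = 11/10 by norm_num]
      gcongr
    have hB1 : ∀ ρ : ℝ, 1 ≤ ρ → ∀ z : ℂ, ‖z‖ ≤ (16 + ‖w‖) * ρ →
        ‖deriv g z‖ ≤ C * Real.exp (((17 + ‖w‖) * ρ) ^ (11/10 : ℝ)) := by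
      intro ρ hρ z hz
      have := Complex.norm_deriv_le_of_forall_mem_sphere_norm_le (c := z) (R := 1) (f := g)
        one_pos hg.diffContOnCl (fun v hv => hB0 ρ hρ v (by
          rw [mem_sphere, dist_eq_norm] at hv
          have : ‖v‖ ≤ ‖v - z‖ + ‖z‖ := by simpa using norm_add_le (v - z) z
          linarith))
      simpa using this
    obtain ⟨K0, hK0, hKb0⟩ := aux_absorb C ‖g w‖ (17 + ‖w‖) hC (norm_pos_iff.2 hw0) hD
    obtain ⟨K1, hK1, hKb1⟩ := aux_absorb C ‖deriv g w‖ (17 + ‖w‖) hC (norm_pos_iff.2 hw1) hD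
    have hzz : ∀ ρ : ℝ, 1 ≤ ρ → ∀ z : ℂ, ‖z‖ ≤ 16 * ρ → ‖z + w‖ ≤ (16 + ‖w‖) * ρ := by
      intro ρ hρ z hz
      have := norm_add_le z w
      nlinarith [norm_nonneg w]
    obtain ⟨k, hk⟩ := aux_core (fun z => g (z + w)) (fun z => φ (z + w))
      (hg.comp (differentiable_id.add_const w)) (hφ.comp (differentiable_id.add_const w))
      (fun z => by rw [hd2]; exact hquot _) (by simpa using hw0) (by rw [hd1]; simpa using hw1)
      (K0 + K1) (by positivity)
      (fun ρ hρ z hz => by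
        simp only [zero_add]
        refine (hB0 ρ hρ _ ((hzz ρ hρ z hz).trans ?_)).trans (hKb0 _ (by linarith) ρ hρ)
        gcongr
        norm_num)
      (fun ρ hρ z hz => by
        simp only [hd1, zero_add]
        exact (hB1 ρ hρ _ (hzz ρ hρ z hz)).trans (hKb1 _ (by linarith) ρ hρ))
    exact ⟨k, fun z => by simpa using hk (z - w)⟩
  · push Not at hcase
    obtain ⟨w, hw⟩ := hne
    have hev : ∀ᶠ z in nhds w, g z ≠ 0 := hg.continuous.continuousAt.eventually_ne hw
    have hphi : ∀ᶠ z in nhds w, φ z = 0 := by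
      have hdz : ∀ᶠ z in nhds w, deriv g z = 0 := hev.mono hcase
      filter_upwards [hev, hdz.eventually_nhds] with z hz hz'
      have h2 : deriv (deriv g) z = 0 := by
        have : deriv g =ᶠ[nhds z] fun _ => (0:ℂ) := hz'
        rw [this.deriv_eq]; simp
      have := hquot z
      rw [h2] at this
      exact (mul_eq_zero.1 this).resolve_right hz
    refine ⟨0, fun z => ?_⟩
    have hA : AnalyticOnNhd ℂ φ Set.univ := fun z _ => hφ.analyticAt z
    exact hA.eqOn_zero_of_preconnected_of_eventuallyEq_zero isPreconnected_univ (Set.mem_univ w)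
      hphi (Set.mem_univ z)
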